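/- Prolongation of the unimodular contact system: let ξ = (ξ¹,ξ²,ξ³) be a smooth vector field on ℝ³ satisfying ∂₃ξ¹ − x³∂₃ξ² = 0, ∂₂ξ¹ − x³∂₂ξ² − ξ³ = 0 and ∂₁ξ¹ − x³∂₁ξ² = 0. Then ξ also satisfies the first-order equations ∂₁ξ² = 0, ∂₁ξ³ = 0, ∂₂ξ² + ∂₃ξ³ = 0 and ∂₁ξ¹ = 0, obtained by crossed derivatives. -/

import Mathlib

/-- The partial derivative of `g : ℝ³ → ℝ` with respect to the `i`-th coordinate. -/
noncomputable def pd (i : Fin 3) (g : (Fin 3 → ℝ) → ℝ) : (Fin 3 → ℝ) → ℝ :=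
  fun x => fderiv ℝ g x (Pi.single i 1)

lemma two_le_smooth_aux : (1 + 1 : WithTop ℕ∞) ≤ ((⊤ : ℕ∞) : WithTop ℕ∞) :=
  WithTop.coe_le_coe.2 (le_top : (1 + 1 : ℕ∞) ≤ ⊤)

lemma pd_differentiable (i : Fin 3) {g : (Fin 3 → ℝ) → ℝ} (hg : ContDiff ℝ (⊤ : ℕ∞) g) :
    Differentiable ℝ (pd i g) := by
  have h : ContDiff ℝ 1 (fderiv ℝ g) := hg.fderiv_right two_le_smooth_aux
  exact (h.differentiable (by norm_num)).clm_apply (differentiable_const _)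

lemma pd_comm (i j : Fin 3) {g : (Fin 3 → ℝ) → ℝ} (hg : ContDiff ℝ (⊤ : ℕ∞) g)
    (x : Fin 3 → ℝ) : pd i (pd j g) x = pd j (pd i g) x := by
  have h : ContDiff ℝ 1 (fderiv ℝ g) := hg.fderiv_right two_le_smooth_aux
  have hd : DifferentiableAt ℝ (fderiv ℝ g) x := h.differentiable (by norm_num) x
  have key : ∀ a b : Fin 3, pd a (pd b g) x
      = fderiv ℝ (fderiv ℝ g) x (Pi.single a 1) (Pi.single b 1) := by
    intro a b
    have := (hd.hasFDerivAt.clm_apply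
      (hasFDerivAt_const (Pi.single b (1 : ℝ) : Fin 3 → ℝ) x)).fderiv
    change fderiv ℝ (fun y => fderiv ℝ g y (Pi.single b 1)) x (Pi.single a 1) = _
    rw [this]
    simp
  rw [key, key]
  have hs : IsSymmSndFDerivAt ℝ g x :=
    (hg.contDiffAt).isSymmSndFDerivAt (by simpa [one_add_one_eq_two] using two_le_smooth_aux)
  exact hs _ _

lemma pd_eq (i : Fin 3) {f g k : (Fin 3 → ℝ) → ℝ} (hg : Differentiable ℝ g)
    (hk : Differentiable ℝ k) (h : ∀ x, f x = x 2 * g x + k x) (x : Fin 3 → ℝ) :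
    pd i f x = x 2 * pd i g x + (Pi.single i (1 : ℝ) : Fin 3 → ℝ) 2 * g x + pd i k x := by
  have hp : HasFDerivAt (fun y : Fin 3 → ℝ => y 2)
      (ContinuousLinearMap.proj (R := ℝ) (φ := fun _ : Fin 3 => ℝ) 2) x := hasFDerivAt_apply 2 x
  have := ((hp.mul (hg x).hasFDerivAt).add (hk x).hasFDerivAt).fderiv
  obtain rfl : f = (fun y => y 2) * g + k := funext h
  unfold pd
  rw [this]
  simp
  ring

/-- Prolongation of the unimodular contact system: if the smooth vector field
`ξ = (ξ¹,ξ²,ξ³)` on `ℝ³` satisfies `∂₃ξ¹ − x³∂₃ξ² = 0`, `∂₂ξ¹ − x³∂₂ξ² − ξ³ = 0`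
and `∂₁ξ¹ − x³∂₁ξ² = 0`, then also `∂₁ξ² = 0`, `∂₁ξ³ = 0`, `∂₂ξ² + ∂₃ξ³ = 0`
and `∂₁ξ¹ = 0`. -/
theorem unimodular_contact_prolongation (ξ1 ξ2 ξ3 : (Fin 3 → ℝ) → ℝ)
    (hξ1 : ContDiff ℝ (⊤ : ℕ∞) ξ1) (hξ2 : ContDiff ℝ (⊤ : ℕ∞) ξ2) (hξ3 : ContDiff ℝ (⊤ : ℕ∞) ξ3)
    (h1 : ∀ x, pd 2 ξ1 x - x 2 * pd 2 ξ2 x = 0)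
    (h2 : ∀ x, pd 1 ξ1 x - x 2 * pd 1 ξ2 x - ξ3 x = 0)
    (h3 : ∀ x, pd 0 ξ1 x - x 2 * pd 0 ξ2 x = 0) :
    (∀ x, pd 0 ξ2 x = 0) ∧ (∀ x, pd 0 ξ3 x = 0) ∧
      (∀ x, pd 1 ξ2 x + pd 2 ξ3 x = 0) ∧ (∀ x, pd 0 ξ1 x = 0) := by
  have d := fun i => pd_differentiable i hξ2
  have d3 : Differentiable ℝ ξ3 := hξ3.differentiable (by simp)
  have z : Differentiable ℝ (fun _ : Fin 3 → ℝ => (0 : ℝ)) := differentiable_const _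
  have pz : ∀ i x, pd i (fun _ : Fin 3 → ℝ => (0 : ℝ)) x = 0 := by intro i x; simp [pd]
  have e1 := fun i => pd_eq i (d 2) z (f := pd 2 ξ1) (fun x => by linarith [h1 x])
  have e2 := fun i => pd_eq i (d 1) d3 (f := pd 1 ξ1) (fun x => by linarith [h2 x])
  have e3 := fun i => pd_eq i (d 0) z (f := pd 0 ξ1) (fun x => by linarith [h3 x])
  have A : ∀ x, pd 0 ξ2 x = 0 := by
    intro x
    have a := e1 0 x
    have b := e3 2 x
    rw [pd_comm 0 2 hξ1, pd_comm 0 2 hξ2, pz] at a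
    rw [pz] at b
    simp at a b
    linarith
  refine ⟨A, ?_, ?_, ?_⟩
  · intro x
    have a := e2 0 x
    have b := e3 1 x
    rw [pd_comm 0 1 hξ1, pd_comm 0 1 hξ2] at a
    rw [pz] at b
    simp at a b
    linarith
  · intro x
    have a := e1 1 x
    have b := e2 2 x
    rw [pd_comm 1 2 hξ1, pd_comm 1 2 hξ2, pz] at a
    simp at a b
    linarith
  · intro x
    have := h3 x
    rw [A x] at this
    linarith
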